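/- Let n, k, d, e be natural numbers with k = d(d−1)/2 + e, 0 ≤ e < d, and k ≤ n(n−1)/2. Let G be the graph on n vertices consisting of a complete graph on d vertices, one additional vertex joined to exactly e vertices of this clique (no additional vertex when e = 0), and all remaining vertices isolated. Then β(H) ≤ β(G) for every finite simple graph H with n vertices and k edges; that is, G attains the maximum of β over all graphs with n vertices and k edges. -/

import Mathlib

noncomputable section

/-- The number of cliques of size `k` in `G` (the empty set is the unique clique of size 0). -/
def cliqueCount {V : Type*} [Fintype V] (G : SimpleGraph V) (k : ℕ) : ℕ :=
  Nat.card {s : Finset V // G.IsNClique k s}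

/-- The clique number `ω(G)` of `G`. -/
def cliqueNum {V : Type*} [Fintype V] (G : SimpleGraph V) : ℕ :=
  sSup {k : ℕ | ∃ s : Finset V, G.IsNClique k s}

/-- The PC-polynomial `PC(G,x) = ∑_{k=0}^{ω(G)} (-1)^k c_k(G) x^{ω(G)-k}`. -/
def PCpoly {V : Type*} [Fintype V] (G : SimpleGraph V) : Polynomial ℝ :=
  ∑ k ∈ Finset.range (cliqueNum G + 1),
    Polynomial.C ((-1 : ℝ) ^ k * (cliqueCount G k : ℝ)) * Polynomial.X ^ (cliqueNum G - k)

/-- `β(G)`, the largest real root of the PC-polynomial of `G`. -/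
def beta {V : Type*} [Fintype V] (G : SimpleGraph V) : ℝ :=
  sSup {x : ℝ | (PCpoly G).eval x = 0}

/-- The graph on `n` vertices consisting of a complete graph on the vertices `0,…,d-1`,
one extra vertex `d` joined to exactly the `e` vertices `0,…,e-1` of the clique,
and all remaining vertices isolated. -/
def fisherGraph (n d e : ℕ) : SimpleGraph (Fin n) :=
  SimpleGraph.fromRel (fun i j =>
    ((i : ℕ) < d ∧ (j : ℕ) < d) ∨ ((i : ℕ) = d ∧ (j : ℕ) < e))

open Finset in
open Classical in
/-- The clique polynomial `∑_R (-t)^|R|`, summed over the cliques `R` of `G` contained in `S`. -/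
def cliqueSum {V : Type*} (G : SimpleGraph V) (S : Finset V) (t : ℝ) : ℝ :=
  ∑ R ∈ S.powerset, if G.IsClique (R : Set V) then (-t) ^ #R else 0

namespace CliqueSum

open Finset

open scoped Classical

variable {V : Type*} (G : SimpleGraph V)

@[simp] lemma empty (t : ℝ) : cliqueSum G ∅ t = 1 := by
  simp [cliqueSum]

lemma insert_eq [DecidableEq V] {v : V} {S : Finset V} (hv : v ∉ S) (t : ℝ) :
    cliqueSum G (insert v S) t
      = cliqueSum G S t - t * cliqueSum G (S.filter (G.Adj v)) t := by
  have key : ∑ R ∈ S.powerset,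
        (if G.IsClique ((insert v R : Finset V) : Set V) then (-t) ^ #(insert v R) else 0)
      = -t * cliqueSum G (S.filter (G.Adj v)) t := by
    rw [cliqueSum, mul_sum, ← sum_subset (powerset_mono.2 (filter_subset (G.Adj v) S))]
    · refine sum_congr rfl fun R hR => ?_
      rw [mem_powerset] at hR
      have hvR : v ∉ R := fun h => hv (mem_filter.1 (hR h)).1
      have hiff : G.IsClique ((insert v R : Finset V) : Set V) ↔ G.IsClique (R : Set V) := by
        rw [coe_insert, SimpleGraph.isClique_insert]
        exact and_iff_left fun b hb _ => (mem_filter.1 (hR hb)).2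
      simp only [hiff, card_insert_of_notMem hvR, pow_succ']
      split_ifs <;> simp
    · intro R hR hR'
      rw [if_neg]
      intro hc
      rw [coe_insert, SimpleGraph.isClique_insert] at hc
      rw [mem_powerset] at hR hR'
      refine hR' fun b hb => mem_filter.2 ⟨hR hb, hc.2 b hb ?_⟩
      rintro rfl
      exact hv (hR hb)
  rw [sub_eq_add_neg, ← neg_mul, ← key]
  unfold cliqueSum
  rw [sum_powerset_insert hv]
  congr!

@[simp] lemma singleton (v : V) (t : ℝ) : cliqueSum G {v} t = 1 - t := by
  rw [← insert_empty_eq, insert_eq G (notMem_empty v)]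
  simp

@[simp] lemma at_zero (S : Finset V) : cliqueSum G S 0 = 1 := by
  induction S using Finset.induction_on with
  | empty => simp
  | insert v S hv ih => rw [insert_eq G hv, ih]; simp

lemma continuous (S : Finset V) : Continuous (cliqueSum G S) := by
  unfold cliqueSum
  refine continuous_finsetSum _ fun R _ => ?_
  split_ifs <;> fun_prop

lemma of_isClique {S : Finset V} (hS : G.IsClique (S : Set V)) (t : ℝ) :
    cliqueSum G S t = (1 - t) ^ #S := by
  induction S using Finset.induction_on with
  | empty => simp
  | insert v S hv ih =>
    rw [coe_insert, SimpleGraph.isClique_insert] at hS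
    have hf : S.filter (G.Adj v) = S := filter_true_of_mem fun b hb => hS.2 b hb <| by
      rintro rfl
      exact hv hb
    rw [insert_eq G hv, hf, ih hS.1, card_insert_of_notMem hv]
    ring

section Nonneg

variable {G} {t : ℝ}

lemma anti (ht : 0 ≤ t) (hG : ∀ R, 0 ≤ cliqueSum G R t) {R S : Finset V} (h : R ⊆ S) :
    cliqueSum G S t ≤ cliqueSum G R t := by
  suffices H : ∀ A : Finset V, cliqueSum G (A ∪ R) t ≤ cliqueSum G R t by
    simpa [union_eq_left.2 h] using H S
  intro A
  induction A using Finset.induction_on with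
  | empty => simp
  | insert v A _ ih =>
    rw [insert_union]
    by_cases hv : v ∈ A ∪ R
    · rwa [insert_eq_self.2 hv]
    · rw [insert_eq G hv]
      have := mul_nonneg ht (hG ((A ∪ R).filter (G.Adj v)))
      linarith

lemma le_pow (ht : 0 ≤ t) (ht1 : t ≤ 1) (hG : ∀ R, 0 ≤ cliqueSum G R t) (S : Finset V) :
    cliqueSum G S t ≤ (1 - t) ^ #S := by
  induction S using Finset.induction_on with
  | empty => simp
  | insert v S hv ih =>
    rw [insert_eq G hv, card_insert_of_notMem hv, pow_succ']
    have h₁ := mul_le_mul_of_nonneg_left (anti ht hG (filter_subset (G.Adj v) S)) ht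
    have h₂ := mul_le_mul_of_nonneg_left ih (sub_nonneg.2 ht1)
    linarith

end Nonneg

/-- The sum of the degrees in the subgraph induced on `S`. -/
def degreeSum (S : Finset V) : ℕ := ∑ v ∈ S, #(S.filter (G.Adj v))

lemma degreeSum_insert {v : V} {S : Finset V} (hv : v ∉ S) :
    degreeSum G (insert v S) = degreeSum G S + 2 * #(S.filter (G.Adj v)) := by
  have h : ∀ w ∈ S, #((insert v S).filter (G.Adj w))
      = #(S.filter (G.Adj w)) + if G.Adj v w then 1 else 0 := by
    intro w _
    rw [filter_insert, G.adj_comm w v]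
    split_ifs
    · rw [card_insert_of_notMem (by simp [hv])]
    · simp
  have hvv : (insert v S).filter (G.Adj v) = S.filter (G.Adj v) := by
    simp [filter_insert]
  rw [degreeSum, sum_insert hv, sum_congr rfl h, sum_add_distrib, hvv, ← card_filter, degreeSum]
  ring

/-- For `k = d(d-1)/2 + e` with `e ≤ d`, the gain `∑ (1 - q ^ b)` over the back degrees `b`
of the Fisher graph with `k` edges. -/
def gain (q : ℝ) (d e : ℕ) : ℝ := ∑ i ∈ range d, (1 - q ^ i) + (1 - q ^ e)

lemma gain_le_add {q : ℝ} (hq : 0 ≤ q) (hq1 : q ≤ 1) {d e δ : ℕ} (h : δ ≤ e) :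
    gain q d e ≤ gain q d (e - δ) + (1 - q ^ δ) := by
  obtain ⟨c, rfl⟩ := Nat.exists_eq_add_of_le h
  have h₁ : 0 ≤ 1 - q ^ c := sub_nonneg.2 (pow_le_one₀ hq hq1)
  have h₂ : 0 ≤ 1 - q ^ δ := sub_nonneg.2 (pow_le_one₀ hq hq1)
  have := mul_nonneg h₁ h₂
  simp only [gain, Nat.add_sub_cancel_left, pow_add]
  linarith

lemma gain_succ_le_add {q : ℝ} (hq : 0 ≤ q) (hq1 : q ≤ 1) {d e δ : ℕ} (h : e ≤ δ) (hd : δ ≤ d) :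
    gain q (d + 1) e ≤ gain q d (d + e - δ) + (1 - q ^ δ) := by
  obtain ⟨a, rfl⟩ := Nat.exists_eq_add_of_le h
  obtain ⟨b, rfl⟩ := Nat.exists_eq_add_of_le hd
  have h₁ : 0 ≤ 1 - q ^ a := sub_nonneg.2 (pow_le_one₀ hq hq1)
  have h₂ : 0 ≤ 1 - q ^ b := sub_nonneg.2 (pow_le_one₀ hq hq1)
  have := mul_nonneg (pow_nonneg hq e) (mul_nonneg h₁ h₂)
  have he : e + a + b + e - (e + a) = e + b := by omega
  simp only [gain, he, sum_range_succ, pow_add]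
  linarith

/-- Removing a vertex of minimum degree repeatedly bounds the clique polynomial of a graph
from below in terms of its numbers of vertices and edges. -/
lemma lower_bound {G : SimpleGraph V} {t : ℝ} (ht : 0 ≤ t) (ht1 : t ≤ 1)
    (hG : ∀ R, 0 ≤ cliqueSum G R t) (S : Finset V) (d e : ℕ) (he : e < d)
    (hS : degreeSum G S = d * (d - 1) + 2 * e) :
    1 - t * #S + t * gain (1 - t) d e ≤ cliqueSum G S t := by
  induction hn : #S generalizing S d e with
  | zero =>
    obtain rfl := card_eq_zero.1 hn
    have h0 : d * (d - 1) + 2 * e = 0 := by rw [← hS]; simp [degreeSum]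
    obtain rfl : e = 0 := by omega
    obtain rfl : d = 1 := by
      rcases Nat.mul_eq_zero.1 (by omega : d * (d - 1) = 0) with h | h <;> omega
    simp [gain]
  | succ n ih =>
    have hne : S.Nonempty := card_pos.1 (by omega)
    obtain ⟨v, hvS, hmin⟩ := exists_min_image S (fun v => #(S.filter (G.Adj v))) hne
    obtain ⟨T, hvT, rfl⟩ : ∃ T, v ∉ T ∧ insert v T = S :=
      ⟨S.erase v, notMem_erase v S, insert_erase hvS⟩
    have hvv : (insert v T).filter (G.Adj v) = T.filter (G.Adj v) := by
      simp [filter_insert]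
    simp only [hvv] at hmin
    rw [card_insert_of_notMem hvT] at hn
    have hcard : #T = n := by omega
    have hdeg : (n + 1) * #(T.filter (G.Adj v)) ≤ d * (d - 1) + 2 * e := by
      rw [← hS, degreeSum, ← hn, ← card_insert_of_notMem hvT, ← smul_eq_mul]
      exact card_nsmul_le_sum _ _ _ hmin
    have hle : #(T.filter (G.Adj v)) ≤ n := hcard ▸ card_filter_le _ _
    rw [degreeSum_insert G hvT] at hS
    rw [insert_eq G hvT]
    have hpow := mul_le_mul_of_nonneg_left (le_pow ht ht1 hG (T.filter (G.Adj v))) ht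
    set δ := #(T.filter (G.Adj v))
    obtain ⟨c, rfl⟩ : ∃ c, d = c + 1 := ⟨d - 1, by omega⟩
    rw [Nat.add_sub_cancel] at hS hdeg
    have hδ : δ ≤ c := by
      by_contra! hc
      have := Nat.mul_le_mul (show c + 2 ≤ n + 1 by omega) (show c + 1 ≤ δ by omega)
      nlinarith
    have hq : 0 ≤ 1 - t := sub_nonneg.2 ht1
    have hq1 : 1 - t ≤ 1 := by linarith
    rcases le_or_gt δ e with h | h
    · have := ih T (c + 1) (e - δ) (by omega) (by rw [Nat.add_sub_cancel]; omega) hcard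
      have hg := mul_le_mul_of_nonneg_left (gain_le_add hq hq1 (d := c + 1) h) ht
      push_cast
      linarith
    · obtain ⟨b, rfl⟩ : ∃ b, c = b + 1 := ⟨c - 1, by omega⟩
      have := ih T (b + 1) (b + 1 + e - δ) (by omega)
        (by
          rw [Nat.add_sub_cancel]
          have : (b + 1 + 1) * (b + 1) = (b + 1) * b + 2 * (b + 1) := by ring
          omega) hcard
      have hg := mul_le_mul_of_nonneg_left (gain_succ_le_add hq hq1 h.le hδ) ht
      push_cast
      linarith

section Fintype

variable [Fintype V]

/-- If the clique polynomial of some induced subgraph is nonpositive at `t`, then the clique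
polynomial of `G` has a root `s ≤ t` at which all induced subgraphs are nonnegative. -/
lemma exists_root {t : ℝ} (ht : 0 ≤ t) {R : Finset V} (hR : cliqueSum G R t ≤ 0) :
    ∃ s, 0 < s ∧ s ≤ t ∧ (∀ R, 0 ≤ cliqueSum G R s) ∧ cliqueSum G univ s = 0 := by
  set m : ℝ → ℝ := fun s => univ.inf' univ_nonempty fun R : Finset V => cliqueSum G R s with hm
  have hcont : Continuous m :=
    Continuous.finset_inf'_apply _ fun R _ => continuous G R
  have h0 : m 0 = 1 := by simp [hm]
  have hmt : m t ≤ 0 := (inf'_le _ (mem_univ R)).trans hR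
  obtain ⟨s, ⟨hs0, hst⟩, hs⟩ := intermediate_value_Icc' ht hcont.continuousOn
    (show (0 : ℝ) ∈ Set.Icc (m t) (m 0) from ⟨hmt, by rw [h0]; exact zero_le_one⟩)
  have hnn : ∀ R, 0 ≤ cliqueSum G R s := fun R => hs ▸ inf'_le _ (mem_univ R)
  obtain ⟨Q, -, hQ⟩ := exists_mem_eq_inf' univ_nonempty fun R : Finset V => cliqueSum G R s
  refine ⟨s, hs0.lt_of_ne ?_, hst, hnn, le_antisymm ?_ (hnn _)⟩
  · rintro rfl
    linarith
  · exact (anti hs0 hnn (subset_univ Q)).trans (hQ.symm.trans hs).le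

lemma eval_PCpoly {x : ℝ} (hx : x ≠ 0) :
    (PCpoly G).eval x = x ^ cliqueNum G * cliqueSum G univ x⁻¹ := by
  have hmem : ∀ R ∈ univ.filter (fun R : Finset V => G.IsClique (R : Set V)),
      #R ∈ range (cliqueNum G + 1) := by
    intro R hR
    exact mem_range.2 (Nat.lt_succ_of_le
      (SimpleGraph.IsClique.card_le_cliqueNum (tc := (mem_filter.1 hR).2)))
  rw [cliqueSum, powerset_univ, ← sum_filter, mul_sum, ← sum_fiberwise_of_maps_to hmem, PCpoly,
    Polynomial.eval_finsetSum]
  refine sum_congr rfl fun k hk => ?_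
  have hk' : k ≤ cliqueNum G := Nat.lt_succ_iff.1 (mem_range.1 hk)
  have hcount : cliqueCount G k
      = #((univ.filter fun R : Finset V => G.IsClique (R : Set V)).filter (#· = k)) := by
    rw [cliqueCount, Nat.card_eq_fintype_card, Fintype.card_subtype, filter_filter]
    simp only [SimpleGraph.isNClique_iff]
  rw [sum_congr rfl fun R hR => by rw [(mem_filter.1 hR).2], sum_const, ← hcount, nsmul_eq_mul,
    Polynomial.eval_mul, Polynomial.eval_C, Polynomial.eval_pow, Polynomial.eval_X,
    pow_sub₀ x hx hk', neg_pow x⁻¹, inv_pow]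
  ring

lemma PCpoly_ne_zero : PCpoly G ≠ 0 := by
  intro h
  have h₁ := eval_PCpoly G (x := -1) (by norm_num)
  have h₂ : 0 < cliqueSum G univ (-1)⁻¹ := by
    refine sum_pos' (fun R _ => ?_) ⟨∅, empty_mem_powerset _, by simp⟩
    split_ifs <;> norm_num
  rw [h, Polynomial.eval_zero] at h₁
  exact mul_ne_zero (pow_ne_zero _ (by norm_num)) h₂.ne' h₁.symm

lemma inv_le_beta {t : ℝ} (ht : 0 < t) {R : Finset V} (hR : cliqueSum G R t ≤ 0) :
    t⁻¹ ≤ beta G := by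
  obtain ⟨s, hs, hst, -, hroot⟩ := exists_root G ht.le hR
  refine (inv_anti₀ hs hst).trans (le_csSup ?_ ?_)
  · exact (Polynomial.finite_setOfPred_isRoot (PCpoly_ne_zero G)).bddAbove
  · rw [Set.mem_ofPred_eq, eval_PCpoly G (inv_ne_zero hs.ne'), inv_inv, hroot, mul_zero]

lemma beta_of_isEmpty [IsEmpty V] : beta G = 0 := by
  have h : ∀ x ∈ {x : ℝ | (PCpoly G).eval x = 0}, x = 0 := by
    intro x hx
    by_contra hx0
    rw [Set.mem_ofPred_eq, eval_PCpoly G hx0, univ_eq_empty, empty, mul_one] at hx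
    exact pow_ne_zero _ hx0 hx
  exact le_antisymm (Real.sSup_le (fun x hx => (h x hx).le) le_rfl)
    (Real.sSup_nonneg fun x hx => (h x hx).ge)

lemma degreeSum_univ : degreeSum G univ = 2 * Nat.card G.edgeSet := by
  rw [Nat.card_eq_fintype_card, ← SimpleGraph.edgeFinset_card,
    ← SimpleGraph.sum_degrees_eq_twice_card_edges, degreeSum]
  simp only [← SimpleGraph.card_neighborFinset_eq_degree, SimpleGraph.neighborFinset_eq_filter]

end Fintype

lemma fisherGraph_initial {n d e : ℕ} (he : e ≤ d) (t : ℝ) {m : ℕ} (hm : m ≤ n) :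
    cliqueSum (fisherGraph n d e) (univ.filter fun i => (i : ℕ) < m) t
      = 1 - t * ∑ j ∈ range m, (1 - t) ^ (if j < d then j else if j = d then e else 0) := by
  induction m with
  | zero => simp
  | succ m ih =>
    set b := if m < d then m else if m = d then e else 0 with hb
    have hbm : b ≤ m ∧ b ≤ d := by
      rw [hb]
      split_ifs <;> omega
    let v : Fin n := ⟨m, hm⟩
    have hins : (univ.filter fun i : Fin n => (i : ℕ) < m + 1)
        = insert v (univ.filter fun i : Fin n => (i : ℕ) < m) := by
      ext i
      simp only [mem_filter_univ, mem_insert, Fin.ext_iff, v]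
      omega
    have hnbr : (univ.filter fun i : Fin n => (i : ℕ) < m).filter ((fisherGraph n d e).Adj v)
        = univ.filter fun i : Fin n => (i : ℕ) < b := by
      ext i
      rw [mem_filter]
      simp only [mem_filter_univ, fisherGraph, SimpleGraph.fromRel_adj, ne_eq,
        Fin.ext_iff, v, hb]
      split_ifs <;> omega
    have hclique : (fisherGraph n d e).IsClique
        ((univ.filter fun i : Fin n => (i : ℕ) < b : Finset (Fin n)) : Set (Fin n)) := by
      intro i hi j hj hij
      simp only [coe_filter, mem_univ, true_and, Set.mem_ofPred_eq] at hi hj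
      rw [fisherGraph, SimpleGraph.fromRel_adj]
      exact ⟨hij, Or.inl (Or.inl ⟨by omega, by omega⟩)⟩
    have hcard : #(univ.filter fun i : Fin n => (i : ℕ) < b) = b := by
      rw [Fin.card_filter_val_lt]
      omega
    rw [hins, insert_eq _ (by simp [v]), ih (by omega), hnbr, of_isClique _ hclique, hcard,
      sum_range_succ]
    ring

lemma fisherGraph_univ {n d e : ℕ} (he : e ≤ d) (hd : d ≤ n) (hde : e = 0 ∨ d < n) (t : ℝ) :
    cliqueSum (fisherGraph n d e) univ t = 1 - t * n + t * gain (1 - t) d e := by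
  have hall : (univ.filter fun i : Fin n => (i : ℕ) < n) = univ := by simp
  have hgain : ∑ j ∈ range n, (1 - (1 - t) ^ (if j < d then j else if j = d then e else 0))
      = gain (1 - t) d e := by
    obtain ⟨r, rfl⟩ := Nat.exists_eq_add_of_le hd
    rw [sum_range_add, gain]
    congr 1
    · exact sum_congr rfl fun j hj => by rw [if_pos (mem_range.1 hj)]
    · cases r with
      | zero =>
        obtain rfl : e = 0 := by omega
        simp
      | succ r => simp [sum_range_succ']
  rw [← hall, fisherGraph_initial he t le_rfl, ← hgain, sum_sub_distrib]
  simp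
  ring

end CliqueSum

/-- If `k = d(d-1)/2 + e` with `0 ≤ e < d` and `k ≤ n(n-1)/2`, the graph `fisherGraph n d e`
maximizes `β` among all graphs with `n` vertices and `k` edges. -/
theorem stmt_15 (n d e k : ℕ) (he : e < d) (hk : k = d * (d - 1) / 2 + e)
    (hkn : k ≤ n * (n - 1) / 2)
    {W : Type} [Fintype W] (H : SimpleGraph W) (hW : Fintype.card W = n)
    (hE : Nat.card H.edgeSet = k) :
    beta H ≤ beta (fisherGraph n d e) := by
  classical
  open CliqueSum in
  rcases Nat.eq_zero_or_pos n with rfl | hn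
  · have : IsEmpty W := Fintype.card_eq_zero_iff.1 hW
    rw [beta_of_isEmpty, beta_of_isEmpty]
  have hd : d ≤ n ∧ (e = 0 ∨ d < n) := by
    obtain ⟨m, rfl⟩ : ∃ m, n = m + 1 := ⟨n - 1, by omega⟩
    obtain ⟨c, rfl⟩ : ∃ c, d = c + 1 := ⟨d - 1, by omega⟩
    simp only [Nat.add_sub_cancel] at hk hkn
    rcases lt_trichotomy m c with h | rfl | h
    · have := Nat.mul_le_mul (show m + 2 ≤ c + 1 by omega) (show m + 1 ≤ c by omega)
      have : (m + 2) * (m + 1) = (m + 1) * m + 2 * (m + 1) := by ring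
      omega
    · omega
    · omega
  have hfisher := fisherGraph_univ he.le hd.1 hd.2
  have hpos : 0 ≤ beta (fisherGraph n d e) := by
    refine le_trans ?_ (inv_le_beta (fisherGraph n d e) one_pos (R := {⟨0, hn⟩}) (by simp))
    simp
  refine Real.sSup_le (fun x hx => ?_) hpos
  rcases le_or_gt x 0 with hx0 | hx0
  · exact hx0.trans hpos
  rw [Set.mem_ofPred_eq, eval_PCpoly H hx0.ne'] at hx
  have hroot := (mul_eq_zero.1 hx).resolve_left (pow_ne_zero _ hx0.ne')
  obtain ⟨s, hs, hsx, hnn, hs0⟩ := exists_root H (inv_pos.2 hx0).le hroot.le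
  obtain ⟨w⟩ : Nonempty W := Fintype.card_pos_iff.1 (hW ▸ hn)
  have hs1 : s ≤ 1 := by simpa using hnn {w}
  have hdeg : degreeSum H Finset.univ = d * (d - 1) + 2 * e := by
    have := Nat.div_two_mul_two_of_even (Nat.even_mul_pred_self d)
    rw [degreeSum_univ, hE, hk]
    omega
  have hlow := lower_bound hs.le hs1 hnn Finset.univ d e he hdeg
  rw [hs0, Finset.card_univ, hW, ← hfisher] at hlow
  exact ((le_inv_comm₀ hs hx0).1 hsx).trans (inv_le_beta _ hs hlow)
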